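/- arXiv:1606.08193 — 2 statements merged into one kernel-verified Lean document; each statement's English description precedes it below -/
import Mathlib

section
/- Let n ≥ 2 be an integer and let A = (a_{i,j})_{1≤i,j≤n} be an n×n matrix over K. Then det of the (n−1)×(n−1) matrix whose (i,j)-entry is a_{i,j}·a_{n,n} − a_{i,n}·a_{n,j} equals a_{n,n}^{n−2} · det A. -/
/-- Clearing the last column of a bordered matrix with pivot `a`. -/
theorem Matrix.det_mul_sub_mul_mul_pivot {R n : Type*} [CommRing R] [Fintype n] [DecidableEq n]
    (M : Matrix n n R) (v w : n → R) (a : R) :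
    (Matrix.of fun i j => M i j * a - v i * w j).det * a =
      a ^ Fintype.card n *
        (Matrix.fromBlocks M (Matrix.replicateCol (Fin 1) v) (Matrix.replicateRow (Fin 1) w)
          (a • (1 : Matrix (Fin 1) (Fin 1) R))).det := by
  have hP : (Matrix.fromBlocks (a • (1 : Matrix n n R)) (-Matrix.replicateCol (Fin 1) v)
      0 1).det = a ^ Fintype.card n := by
    rw [Matrix.det_fromBlocks_zero₂₁, Matrix.det_one, mul_one, Matrix.det_smul, Matrix.det_one,
      mul_one]
  have hM : a • (1 : Matrix n n R) * M +
      -Matrix.replicateCol (Fin 1) v * Matrix.replicateRow (Fin 1) w =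
        Matrix.of fun i j => M i j * a - v i * w j := by
    ext i j
    simp [Matrix.mul_apply, mul_comm, sub_eq_add_neg]
  have hcol : a • (1 : Matrix n n R) * Matrix.replicateCol (Fin 1) v +
      -Matrix.replicateCol (Fin 1) v * (a • (1 : Matrix (Fin 1) (Fin 1) R)) = 0 := by
    simp
  rw [← hP, ← Matrix.det_mul, Matrix.fromBlocks_multiply, hM, hcol, Matrix.det_fromBlocks_zero₁₂]
  simp

/-- Pivotal condensation for a bordered matrix; the pivot need not be regular, since it can be
replaced by the monic polynomial `X + C a`. -/
theorem Matrix.det_mul_sub_mul_eq_pow_mul_det {R n : Type*} [CommRing R] [Fintype n]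
    [DecidableEq n] {m : ℕ} (hn : Fintype.card n = m + 1)
    (M : Matrix n n R) (v w : n → R) (a : R) :
    (Matrix.of fun i j => M i j * a - v i * w j).det =
      a ^ m *
        (Matrix.fromBlocks M (Matrix.replicateCol (Fin 1) v) (Matrix.replicateRow (Fin 1) w)
          (a • (1 : Matrix (Fin 1) (Fin 1) R))).det := by
  have h := Matrix.det_mul_sub_mul_mul_pivot (M.map Polynomial.C)
    (fun i => Polynomial.C (v i)) (fun i => Polynomial.C (w i)) (Polynomial.X + Polynomial.C a)
  rw [hn, pow_succ, mul_right_comm] at h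
  have h' := congrArg (Polynomial.evalRingHom 0)
    ((Polynomial.monic_X_add_C a).isRegular.right h)
  rw [map_mul, map_pow, RingHom.map_det, RingHom.map_det] at h'
  have hM : (Polynomial.evalRingHom 0).mapMatrix (Matrix.of fun i j =>
      M.map Polynomial.C i j * (Polynomial.X + Polynomial.C a) -
        Polynomial.C (v i) * Polynomial.C (w j)) =
      Matrix.of fun i j => M i j * a - v i * w j := by
    ext i j
    simp
  have hB : (Polynomial.evalRingHom 0).mapMatrix (Matrix.fromBlocks (M.map Polynomial.C)
      (Matrix.replicateCol (Fin 1) fun i => Polynomial.C (v i))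
      (Matrix.replicateRow (Fin 1) fun i => Polynomial.C (w i))
      ((Polynomial.X + Polynomial.C a) • (1 : Matrix (Fin 1) (Fin 1) (Polynomial R)))) =
      Matrix.fromBlocks M (Matrix.replicateCol (Fin 1) v) (Matrix.replicateRow (Fin 1) w)
        (a • (1 : Matrix (Fin 1) (Fin 1) R)) := by
    ext (i | i) (j | j) <;> simp [Matrix.one_apply, eq_iff_true_of_subsingleton]
  rw [hM, hB] at h'
  simpa using h'

/-- **Chio Pivotal Condensation.** For an integer `n ≥ 2` (written `n = m + 2`) and an
`n × n` matrix `A` over a commutative ring `K`, the determinant of the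
`(n-1) × (n-1)` matrix with `(i,j)`-entry `a_{i,j} a_{n,n} - a_{i,n} a_{n,j}` equals
`a_{n,n} ^ (n - 2) * det A`. -/
theorem chio_pivotal_condensation {K : Type*} [CommRing K] (m : ℕ)
    (A : Matrix (Fin (m + 2)) (Fin (m + 2)) K) :
    Matrix.det (Matrix.of fun i j : Fin (m + 1) =>
      A i.castSucc j.castSucc * A (Fin.last (m + 1)) (Fin.last (m + 1)) -
        A i.castSucc (Fin.last (m + 1)) * A (Fin.last (m + 1)) j.castSucc) =
      A (Fin.last (m + 1)) (Fin.last (m + 1)) ^ m * A.det := by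
  refine (Matrix.det_mul_sub_mul_eq_pow_mul_det (Fintype.card_fin (m + 1))
    (Matrix.of fun i j : Fin (m + 1) => A i.castSucc j.castSucc)
    (fun i => A i.castSucc (Fin.last (m + 1))) (fun j => A (Fin.last (m + 1)) j.castSucc)
    (A (Fin.last (m + 1)) (Fin.last (m + 1)))).trans ?_
  rw [← Matrix.det_submatrix_equiv_self (finSumFinEquiv (m := m + 1) (n := 1)) A]
  congr 2
  have hlast (x : Fin 1) : Fin.natAdd (m + 1) x = Fin.last (m + 1) := by
    ext
    simp
  have hcast (x : Fin (m + 1)) : Fin.castAdd 1 x = x.castSucc := rfl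
  ext (i | i) (j | j) <;> simp [hlast, hcast, Matrix.one_apply, eq_iff_true_of_subsingleton]
end

section
/- Let n ≥ 2 be an integer, A = (a_{i,j})_{1≤i,j≤n} an n×n matrix over K, and f : {1,…,n} → {1,…,n} an n-potent map. Let B be the (n−1)×(n−1) matrix with (i,j)-entry a_{i,j}·a_{f(i),n} − a_{i,n}·a_{f(i),j}. Then det B = (abut_f A) · det A. -/
namespace Matrix

/-- A matrix whose nonzero off-diagonal entries strictly decrease a height function has
determinant equal to the product of its diagonal entries. -/
theorem det_eq_prod_diag_of_height {ι R : Type*} [Fintype ι] [DecidableEq ι] [CommRing R]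
    (M : Matrix ι ι R) (d : ι → ℕ) (h : ∀ i j, i ≠ j → d i ≤ d j → M i j = 0) :
    M.det = ∏ i, M i i := by
  rw [det_apply, Finset.sum_eq_single 1]
  · simp
  · intro σ _ hσ
    suffices ∃ i, M (σ i) i = 0 by
      obtain ⟨i, hi⟩ := this
      rw [Finset.prod_eq_zero (f := fun i => M (σ i) i) (Finset.mem_univ i) hi, smul_zero]
    by_contra! hne
    have hle (i : ι) : d i ≤ d (σ i) := by
      by_cases hi : σ i = i
      · rw [hi]
      · by_contra! hlt
        exact hne i (h _ _ hi hlt.le)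
    have heq := (Finset.sum_eq_sum_iff_of_le fun i _ => hle i).1 (Equiv.sum_comp σ d).symm
    refine hσ (Equiv.ext fun i => ?_)
    by_contra hi
    exact hne i (h _ _ hi (heq i (Finset.mem_univ i)).ge)
  · simp

theorem det_eq_mul_det_of_last_column_eq_zero {R : Type*} [CommRing R] {n : ℕ}
    (M : Matrix (Fin (n + 1)) (Fin (n + 1)) R)
    (h : ∀ i : Fin n, M i.castSucc (Fin.last n) = 0) :
    M.det = M (Fin.last n) (Fin.last n) * (M.submatrix Fin.castSucc Fin.castSucc).det := by
  rw [det_succ_column M (Fin.last n), Fin.sum_univ_castSucc]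
  simp [h, Fin.succAbove_last, ← two_mul]

end Matrix

section NPotent

variable {K : Type*} [CommRing K] {m : ℕ}

/-- The `n × n` matrix whose `i`-th row is `a_{f(i),n} e_i - a_{i,n} e_{f(i)}` for `i < n` and
whose last row is `e_n`. -/
def abutMatrix (A : Matrix (Fin (m + 1)) (Fin (m + 1)) K) (f : Fin (m + 1) → Fin (m + 1)) :
    Matrix (Fin (m + 1)) (Fin (m + 1)) K :=
  Matrix.of fun i => if i = Fin.last m then Pi.single i 1 else
    Pi.single i (A (f i) (Fin.last m)) - Pi.single (f i) (A i (Fin.last m))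

theorem abutMatrix_mul_castSucc (A : Matrix (Fin (m + 1)) (Fin (m + 1)) K)
    (f : Fin (m + 1) → Fin (m + 1)) (i : Fin m) (j : Fin (m + 1)) :
    (abutMatrix A f * A) i.castSucc j = A i.castSucc j * A (f i.castSucc) (Fin.last m) -
      A i.castSucc (Fin.last m) * A (f i.castSucc) j := by
  simp [Matrix.mul_apply, abutMatrix, (Fin.castSucc_lt_last i).ne, Pi.single_apply,
    sub_mul, mul_comm (A _ (Fin.last m))]

theorem abutMatrix_mul_last (A : Matrix (Fin (m + 1)) (Fin (m + 1)) K)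
    (f : Fin (m + 1) → Fin (m + 1)) (j : Fin (m + 1)) :
    (abutMatrix A f * A) (Fin.last m) j = A (Fin.last m) j := by
  simp [Matrix.mul_apply, abutMatrix, Pi.single_apply]

theorem det_abutMatrix (A : Matrix (Fin (m + 1)) (Fin (m + 1)) K)
    (f : Fin (m + 1) → Fin (m + 1)) (hpot : ∀ i, ∃ k : ℕ, f^[k] i = Fin.last m) :
    (abutMatrix A f).det = ∏ i : Fin m, A (f i.castSucc) (Fin.last m) := by
  have hlt (i : Fin (m + 1)) (hi : i ≠ Fin.last m) :
      Nat.find (hpot (f i)) < Nat.find (hpot i) := by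
    obtain ⟨k, hk⟩ : ∃ k, Nat.find (hpot i) = k + 1 :=
      Nat.exists_eq_succ_of_ne_zero fun h0 => hi (by simpa using (Nat.find_eq_zero _).1 h0)
    have hspec := Nat.find_spec (hpot i)
    rw [hk, Function.iterate_succ_apply] at hspec
    have := Nat.find_min' (hpot (f i)) hspec
    omega
  rw [Matrix.det_eq_prod_diag_of_height _ (fun i => Nat.find (hpot i)), Fin.prod_univ_castSucc]
  · have hfix (i : Fin m) : i.castSucc ≠ f i.castSucc := fun h => by
      have := hlt _ (Fin.castSucc_lt_last i).ne
      simp only [← h, lt_irrefl] at this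
    simp [abutMatrix, (Fin.castSucc_lt_last _).ne, hfix]
  · intro i j hij hd
    by_cases hi : i = Fin.last m
    · simp [abutMatrix, hi, show j ≠ Fin.last m from hi ▸ hij.symm]
    · have hj : j ≠ f i := by
        rintro rfl
        exact absurd (hlt i hi) hd.not_gt
      simp [abutMatrix, hi, hij.symm, hj]

theorem prod_map_eq_pow_mul_prod_filter (c : Fin (m + 2) → K) (f : Fin (m + 2) → Fin (m + 2))
    (hf : f (Fin.last (m + 1)) = Fin.last (m + 1))
    (hpot : ∀ i, ∃ k : ℕ, f^[k] i = Fin.last (m + 1)) :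
    ∏ i : Fin (m + 1), c (f i.castSucc) = c (Fin.last (m + 1)) *
      (c (Fin.last (m + 1)) ^ ((Finset.univ.filter fun i => f i = Fin.last (m + 1)).card - 2) *
        ∏ i ∈ Finset.univ.filter (fun i : Fin (m + 1) => f i.castSucc ≠ Fin.last (m + 1)),
          c (f i.castSucc)) := by
  have hcard : (Finset.univ.filter fun i => f i = Fin.last (m + 1)).card =
      (Finset.univ.filter fun i : Fin (m + 1) => f i.castSucc = Fin.last (m + 1)).card + 1 := by
    simp only [Finset.card_filter, Fin.sum_univ_castSucc (n := m + 1), hf, if_true]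
  have hpos : 0 < (Finset.univ.filter
      fun i : Fin (m + 1) => f i.castSucc = Fin.last (m + 1)).card := by
    rw [Finset.card_pos]
    by_contra hempty
    have hne (i : Fin (m + 2)) (hi : i ≠ Fin.last (m + 1)) : f i ≠ Fin.last (m + 1) := fun h =>
      hempty ⟨i.castPred hi, by simpa using h⟩
    obtain ⟨k, hk⟩ := hpot 0
    have hiter (k : ℕ) : f^[k] 0 ≠ Fin.last (m + 1) := by
      induction k with
      | zero => exact (Fin.last_pos).ne
      | succ k ih => rw [Function.iterate_succ_apply']; exact hne _ ih
    exact hiter k hk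
  rw [← Finset.prod_filter_mul_prod_filter_not Finset.univ
    (fun i : Fin (m + 1) => f i.castSucc = Fin.last (m + 1)), ← mul_assoc, ← pow_succ']
  congr 1
  rw [Finset.prod_congr rfl (g := fun _ => c (Fin.last (m + 1)))
    fun i hi => by rw [(Finset.mem_filter.1 hi).2], Finset.prod_const]
  congr 1
  omega

/-- The determinant identity up to the common factor `a_{n,n}`. -/
theorem last_mul_det_eq_last_mul_abut_mul_det (A : Matrix (Fin (m + 2)) (Fin (m + 2)) K)
    (f : Fin (m + 2) → Fin (m + 2)) (hf : f (Fin.last (m + 1)) = Fin.last (m + 1))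
    (hpot : ∀ i, ∃ k : ℕ, f^[k] i = Fin.last (m + 1)) :
    A (Fin.last (m + 1)) (Fin.last (m + 1)) * Matrix.det (Matrix.of fun i j : Fin (m + 1) =>
      A i.castSucc j.castSucc * A (f i.castSucc) (Fin.last (m + 1)) -
        A i.castSucc (Fin.last (m + 1)) * A (f i.castSucc) j.castSucc) =
    A (Fin.last (m + 1)) (Fin.last (m + 1)) * ((A (Fin.last (m + 1)) (Fin.last (m + 1)) ^
        ((Finset.univ.filter fun i => f i = Fin.last (m + 1)).card - 2) *
      ∏ i ∈ Finset.univ.filter (fun i : Fin (m + 1) => f i.castSucc ≠ Fin.last (m + 1)),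
        A (f i.castSucc) (Fin.last (m + 1))) * A.det) := by
  rw [← mul_assoc, ← prod_map_eq_pow_mul_prod_filter (fun i => A i (Fin.last (m + 1))) f hf hpot,
    ← det_abutMatrix A f hpot, ← Matrix.det_mul,
    Matrix.det_eq_mul_det_of_last_column_eq_zero (abutMatrix A f * A)]
  · rw [abutMatrix_mul_last]
    congr 2
    ext i j
    simp [abutMatrix_mul_castSucc]
  · intro i
    rw [abutMatrix_mul_castSucc, mul_comm, sub_eq_zero, mul_comm]

end NPotent


/-- For an integer `n ≥ 2` (written `n = m + 2`), an `n × n` matrix `A` over a commutative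
ring `K`, and an `n`-potent map `f` (i.e. `f n = n` and every `i` satisfies
`f^[k] i = n` for some `k`), the `(n-1) × (n-1)` matrix with `(i,j)`-entry
`a_{i,j} a_{f(i),n} - a_{i,n} a_{f(i),j}` has determinant `(abut_f A) * det A`, where
`abut_f A = a_{n,n} ^ (|f⁻¹(n)| - 2) * ∏_{i < n, f(i) ≠ n} a_{f(i),n}`. -/
theorem det_eq_abut_mul_det_of_npotent {K : Type*} [CommRing K] (m : ℕ)
    (A : Matrix (Fin (m + 2)) (Fin (m + 2)) K)
    (f : Fin (m + 2) → Fin (m + 2)) (hf : f (Fin.last (m + 1)) = Fin.last (m + 1))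
    (hpot : ∀ i, ∃ k : ℕ, f^[k] i = Fin.last (m + 1)) :
    Matrix.det (Matrix.of fun i j : Fin (m + 1) =>
      A i.castSucc j.castSucc * A (f i.castSucc) (Fin.last (m + 1)) -
        A i.castSucc (Fin.last (m + 1)) * A (f i.castSucc) j.castSucc) =
    (A (Fin.last (m + 1)) (Fin.last (m + 1)) ^
        ((Finset.univ.filter fun i => f i = Fin.last (m + 1)).card - 2) *
      ∏ i ∈ Finset.univ.filter (fun i : Fin (m + 1) => f i.castSucc ≠ Fin.last (m + 1)),
        A (f i.castSucc) (Fin.last (m + 1))) * A.det := by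
  have hgen := mul_left_cancel₀ (MvPolynomial.X_ne_zero (R := ℤ) _)
    (last_mul_det_eq_last_mul_abut_mul_det (Matrix.mvPolynomialX _ _ ℤ) f hf hpot)
  have hmap := congrArg (MvPolynomial.eval₂Hom (Int.castRingHom K) fun p => A p.1 p.2) hgen
  simp only [map_mul, map_pow, map_prod, RingHom.map_det] at hmap
  convert hmap using 2
  · ext i j
    simp
  · simp
  · congr 1
    ext i j
    simp
end
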